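/- Let m ≥ 3 and let U ⊆ ℝ^m be a domain. Let F⃗ = (F₁,...,F_m) be a C¹ vector field and u, v C² functions on U such that ∇u + F⃗ ≠ 0 and ∇v + F⃗ ≠ 0 everywhere on U. Suppose H_F(u) ≤ H_F(v) in U, u ≥ v in U, and u = v at some point p₀ ∈ U. Assume that at every point of U the skew-symmetric m×m matrix (∂_k F_j − ∂_j F_k)_{k,j} has rank ≥ 3. Then u ≡ v in U. -/

import Mathlib

open Set Finset

noncomputable section

/-- The `k`-th standard basis vector of `ℝ^N` (zero if `k ≥ N`). -/
def ee (N k : ℕ) : Fin N → ℝ := fun i => if (i : ℕ) = k then 1 else 0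

/-- The `k`-th partial derivative. -/
def pd (N k : ℕ) (f : (Fin N → ℝ) → ℝ) (x : Fin N → ℝ) : ℝ := fderiv ℝ f x (ee N k)

/-- `∇u + F`. -/
def gradF (N : ℕ) (F : (Fin N → ℝ) → (Fin N → ℝ)) (u : (Fin N → ℝ) → ℝ)
    (x : Fin N → ℝ) : Fin N → ℝ :=
  fun i => pd N i u x + F x i

/-- The Legendrian (horizontal) normal `N_F(u) = (∇u + F)/|∇u + F|`. -/
def legN (N : ℕ) (F : (Fin N → ℝ) → (Fin N → ℝ)) (u : (Fin N → ℝ) → ℝ)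
    (x : Fin N → ℝ) : Fin N → ℝ :=
  fun i => gradF N F u x i / Real.sqrt (∑ k, (gradF N F u x k) ^ 2)

/-- The horizontal (p-)mean curvature `H_F(u) = div N_F(u)`. -/
def Hmc (N : ℕ) (F : (Fin N → ℝ) → (Fin N → ℝ)) (u : (Fin N → ℝ) → ℝ)
    (x : Fin N → ℝ) : ℝ :=
  ∑ i : Fin N, pd N (i : ℕ) (fun y => legN N F u y i) x

/-- The curl matrix `(∂_k F_j − ∂_j F_k)_{k,j}`. -/
def curlMatrix (m : ℕ) (F : (Fin m → ℝ) → (Fin m → ℝ)) (x : Fin m → ℝ) :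
    Matrix (Fin m) (Fin m) ℝ :=
  Matrix.of fun k j => pd m k (fun y => F y j) x - pd m j (fun y => F y k) x

open Filter Topology Matrix

/-- The linear functional `b ↦ a ⬝ᵥ b`. -/
def dotCLM {n : ℕ} (a : Fin n → ℝ) : (Fin n → ℝ) →L[ℝ] ℝ :=
  ∑ i, a i • ContinuousLinearMap.proj i

theorem dotCLM_apply {n : ℕ} (a b : Fin n → ℝ) : dotCLM a b = a ⬝ᵥ b := by
  simp [dotCLM, dotProduct]

theorem dotCLM_smul {n : ℕ} (c : ℝ) (a : Fin n → ℝ) : dotCLM (c • a) = c • dotCLM a := by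
  ext b; simp [dotCLM_apply]

theorem dotCLM_add {n : ℕ} (a b : Fin n → ℝ) : dotCLM (a + b) = dotCLM a + dotCLM b := by
  ext c; simp [dotCLM_apply, add_dotProduct]

theorem eq_zero_of_dotCLM_eq_zero {n : ℕ} {a : Fin n → ℝ} (h : dotCLM a = 0) : a = 0 := by
  ext i
  have := congrArg (fun L => L (Pi.single i 1)) h
  simpa [dotCLM_apply] using this

/-- On `s`, the function `h` is twice continuously differentiable with gradient `g` and
Hessian `A`. -/
structure JetOn {n : ℕ} (s : Set (Fin n → ℝ)) (h : (Fin n → ℝ) → ℝ)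
    (g : (Fin n → ℝ) → (Fin n → ℝ)) (A : (Fin n → ℝ) → Matrix (Fin n) (Fin n) ℝ) : Prop where
  hasGrad : ∀ x ∈ s, HasFDerivAt h (dotCLM (g x)) x
  hasHess : ∀ x ∈ s, ∀ i, HasFDerivAt (fun y => g y i) (dotCLM (A x i)) x
  contHess : ∀ i j, ContinuousOn (fun x => A x i j) s

namespace JetOn

variable {n : ℕ} {s : Set (Fin n → ℝ)} {h h₁ h₂ : (Fin n → ℝ) → ℝ}
  {g g₁ g₂ : (Fin n → ℝ) → (Fin n → ℝ)} {A A₁ A₂ : (Fin n → ℝ) → Matrix (Fin n) (Fin n) ℝ}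

theorem continuousOn (H : JetOn s h g A) : ContinuousOn h s := fun x hx =>
  (H.hasGrad x hx).continuousAt.continuousWithinAt

theorem continuousOn_grad (H : JetOn s h g A) (i : Fin n) : ContinuousOn (fun x => g x i) s :=
  fun x hx => (H.hasHess x hx i).continuousAt.continuousWithinAt

theorem mono (H : JetOn s h g A) {t : Set (Fin n → ℝ)} (hts : t ⊆ s) : JetOn t h g A :=
  ⟨fun x hx => H.hasGrad x (hts hx), fun x hx => H.hasHess x (hts hx),
    fun i j => (H.contHess i j).mono hts⟩

theorem add (H₁ : JetOn s h₁ g₁ A₁) (H₂ : JetOn s h₂ g₂ A₂) :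
    JetOn s (fun x => h₁ x + h₂ x) (fun x => g₁ x + g₂ x) (fun x => A₁ x + A₂ x) := by
  refine ⟨fun x hx => ?_, fun x hx i => ?_, fun i j => ?_⟩
  · rw [dotCLM_add]
    exact (H₁.hasGrad x hx).add (H₂.hasGrad x hx)
  · have := (H₁.hasHess x hx i).add (H₂.hasHess x hx i)
    rw [← dotCLM_add] at this
    exact this
  · exact (H₁.contHess i j).add (H₂.contHess i j)

theorem const_mul (H : JetOn s h g A) (c : ℝ) :
    JetOn s (fun x => c * h x) (fun x => c • g x) (fun x => c • A x) := by
  refine ⟨fun x hx => ?_, fun x hx i => ?_, fun i j => ?_⟩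
  · rw [dotCLM_smul]
    exact (H.hasGrad x hx).const_mul c
  · have := (H.hasHess x hx i).const_mul c
    rw [← dotCLM_smul] at this
    exact this
  · exact continuousOn_const.mul (H.contHess i j)

theorem sq (H : JetOn s h g A) :
    JetOn s (fun x => h x ^ 2) (fun x => (2 * h x) • g x)
      (fun x => (2 * h x) • A x + (2 : ℝ) • vecMulVec (g x) (g x)) := by
  refine ⟨fun x hx => ?_, fun x hx i => ?_, fun i j => ?_⟩
  · rw [dotCLM_smul]
    simpa using (H.hasGrad x hx).pow 2
  · have := ((H.hasGrad x hx).const_mul 2).mul (H.hasHess x hx i)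
    refine this.congr_fderiv ?_
    ext b
    simp [dotCLM_apply, dotProduct, vecMulVec_apply, Finset.mul_sum, add_mul,
      ← Finset.sum_add_distrib]
    refine Finset.sum_congr rfl fun j _ => ?_
    ring
  · exact ((continuousOn_const.mul H.continuousOn).mul (H.contHess i j)).add
      (continuousOn_const.mul ((H.continuousOn_grad i).mul (H.continuousOn_grad j)))

theorem const (c : ℝ) : JetOn s (fun _ => c) (fun _ => 0) (fun _ => 0) := by
  refine ⟨fun x _ => ?_, fun x _ i => ?_, fun i j => continuousOn_const⟩
  · refine (hasFDerivAt_const c x).congr_fderiv ?_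
    ext b; simp [dotCLM_apply]
  · refine (hasFDerivAt_const (0 : ℝ) x).congr_fderiv ?_
    ext b
    rw [dotCLM_apply]
    simp [dotProduct]

theorem linear (a y : Fin n → ℝ) :
    JetOn s (fun x => a ⬝ᵥ (x - y)) (fun _ => a) (fun _ => 0) := by
  refine ⟨fun x _ => ?_, fun x _ i => ?_, fun i j => continuousOn_const⟩
  · simp only [← dotCLM_apply]
    exact (dotCLM a).hasFDerivAt.comp x ((hasFDerivAt_id x).sub_const y)
  · refine (hasFDerivAt_const (a i) x).congr_fderiv ?_
    ext b
    rw [dotCLM_apply]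
    simp [dotProduct]

theorem quad {T : Matrix (Fin n) (Fin n) ℝ} (hT : Tᵀ = T) (y : Fin n → ℝ) :
    JetOn s (fun x => (x - y) ⬝ᵥ T *ᵥ (x - y)) (fun x => (2 : ℝ) • T *ᵥ (x - y))
      (fun _ => (2 : ℝ) • T) := by
  have key : ∀ x i, HasFDerivAt (fun x => (T *ᵥ (x - y)) i) (dotCLM (T i)) x := fun x i => by
    have := (JetOn.linear (s := univ) (T i) y).hasGrad x (mem_univ _)
    exact this
  refine ⟨fun x _ => ?_, fun x _ i => ?_, fun i j => continuousOn_const⟩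
  · have h1 : ∀ i ∈ (Finset.univ : Finset (Fin n)),
        HasFDerivAt (fun x : Fin n → ℝ => (x - y) i * (T *ᵥ (x - y)) i) _ x := fun i _ =>
      HasFDerivAt.mul (((ContinuousLinearMap.proj (R := ℝ) (φ := fun _ : Fin n => ℝ)
        i).hasFDerivAt (x := x)).sub_const (y i)) (key x i)
    have h2 := HasFDerivAt.fun_sum h1
    refine h2.congr_fderiv ?_
    ext b
    simp only [_root_.sum_apply, _root_.add_apply,
      _root_.smul_apply, dotCLM_apply, ContinuousLinearMap.proj_apply, smul_eq_mul]
    rw [Finset.sum_add_distrib]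
    change (x - y) ⬝ᵥ T *ᵥ b + (T *ᵥ (x - y)) ⬝ᵥ b = _
    rw [dotProduct_mulVec, ← mulVec_transpose, hT, smul_dotProduct, smul_eq_mul, two_mul]
  · have := (key x i).const_mul 2
    rw [← dotCLM_smul] at this
    exact this

/-- First and second order necessary conditions at an interior minimum. -/
theorem grad_eq_zero_of_isLocalMin (H : JetOn s h g A) {p : Fin n → ℝ} (hp : p ∈ s)
    (hmin : IsLocalMin h p) : g p = 0 :=
  eq_zero_of_dotCLM_eq_zero (hmin.hasFDerivAt_eq_zero (H.hasGrad p hp))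

theorem hess_nonneg_of_isLocalMin (H : JetOn s h g A) (hs : IsOpen s) {p : Fin n → ℝ}
    (hp : p ∈ s) (hmin : IsLocalMin h p) (b : Fin n → ℝ) : 0 ≤ b ⬝ᵥ A p *ᵥ b := by
  by_contra! hneg
  have hg := H.grad_eq_zero_of_isLocalMin hp hmin
  set l : ℝ → (Fin n → ℝ) := fun t => p + t • b with hl
  have hlc : Continuous l := by fun_prop
  have hl0 : l 0 = p := by simp [hl]
  have hld : ∀ t, HasDerivAt l b t := fun t => by
    have := ((hasDerivAt_id t).smul_const b).const_add p
    rw [one_smul] at this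
    exact this
  have hmem : ∀ᶠ t in 𝓝 (0 : ℝ), l t ∈ s :=
    hlc.continuousAt.eventually (by rw [hl0]; exact hs.mem_nhds hp)
  have hd1 : ∀ᶠ t in 𝓝 (0 : ℝ), deriv (fun t => h (l t)) t = g (l t) ⬝ᵥ b := by
    filter_upwards [hmem] with t ht
    have := ((H.hasGrad _ ht).comp_hasDerivAt t (hld t)).deriv
    rwa [dotCLM_apply] at this
  have hd2 : HasDerivAt (fun t => g (l t) ⬝ᵥ b) (b ⬝ᵥ A p *ᵥ b) 0 := by
    have h1 : ∀ i ∈ (Finset.univ : Finset (Fin n)),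
        HasDerivAt (fun t => g (l t) i * b i) ((A p i ⬝ᵥ b) * b i) 0 := fun i _ => by
      have h2 : HasFDerivAt (fun y => g y i) (dotCLM (A p i)) (l 0) := by
        rw [hl0]; exact H.hasHess p hp i
      have := (h2.comp_hasDerivAt 0 (hld 0)).mul_const (b i)
      rwa [dotCLM_apply] at this
    refine (HasDerivAt.fun_sum h1).congr_deriv ?_
    exact Finset.sum_congr rfl fun i _ => mul_comm _ _
  have hdd : deriv (deriv fun t => h (l t)) 0 = b ⬝ᵥ A p *ᵥ b :=
    (Filter.EventuallyEq.deriv_eq hd1).trans hd2.deriv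
  have hmax : IsLocalMax (fun t => h (l t)) 0 := by
    refine isLocalMax_of_deriv_deriv_neg (by rw [hdd]; exact hneg) ?_ ?_
    · rw [hd1.self_of_nhds, hl0, hg, zero_dotProduct]
    · exact ContinuousAt.comp (by rw [hl0]; exact (H.hasGrad p hp).continuousAt) hlc.continuousAt
  have hmin' : IsLocalMin (fun t => h (l t)) 0 := by
    have : ∀ᶠ t in 𝓝 (0 : ℝ), h p ≤ h (l t) :=
      hlc.continuousAt.eventually (by rw [hl0]; exact hmin)
    unfold IsLocalMin IsMinFilter
    simpa [hl0] using this
  have hconst : (fun t => h (l t)) =ᶠ[𝓝 0] fun _ => h (l 0) := by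
    filter_upwards [hmax, hmin'] with t h1 h2
    exact le_antisymm h1 h2
  have h3 : deriv (fun t => h (l t)) =ᶠ[𝓝 0] fun _ => 0 := by
    refine hconst.deriv.trans ?_
    simp
  rw [h3.deriv_eq] at hdd
  simp at hdd
  linarith

end JetOn

/-- The second order operator `|w|² tr A - wᵀ A w`. -/
def horTrace {n : ℕ} (w : Fin n → ℝ) (A : Matrix (Fin n) (Fin n) ℝ) : ℝ :=
  (w ⬝ᵥ w) * A.trace - w ⬝ᵥ A *ᵥ w

section horTrace

variable {n : ℕ} (w : Fin n → ℝ) (A B : Matrix (Fin n) (Fin n) ℝ)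

theorem horTrace_add : horTrace w (A + B) = horTrace w A + horTrace w B := by
  simp [horTrace, trace_add, add_mulVec, dotProduct_add]; ring

theorem horTrace_smul (c : ℝ) : horTrace w (c • A) = c * horTrace w A := by
  simp [horTrace, trace_smul, smul_mulVec, dotProduct_smul]; ring

theorem horTrace_vecMulVec (v : Fin n → ℝ) :
    horTrace w (vecMulVec v v) = (w ⬝ᵥ w) * (v ⬝ᵥ v) - (w ⬝ᵥ v) ^ 2 := by
  simp [horTrace, trace_vecMulVec, vecMulVec_mulVec, dotProduct_comm v w]; ring

theorem two_mul_horTrace : 2 * horTrace w A = ∑ i, ∑ j,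
    (w i • Pi.single j 1 - w j • Pi.single i 1 : Fin n → ℝ) ⬝ᵥ
      A *ᵥ (w i • Pi.single j 1 - w j • Pi.single i 1) := by
  have e : ∀ i j, (w i • Pi.single j 1 - w j • Pi.single i 1 : Fin n → ℝ) ⬝ᵥ
      A *ᵥ (w i • Pi.single j 1 - w j • Pi.single i 1) =
      w i * w i * A j j - w i * (A i j * w j) - w j * (A j i * w i) + w j * w j * A i i := by
    intro i j
    simp [mulVec_sub, sub_dotProduct, mulVec_smul]
    ring
  simp only [e, Finset.sum_add_distrib, Finset.sum_sub_distrib]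
  have h1 : ∑ i, ∑ j, w i * w i * A j j = (w ⬝ᵥ w) * A.trace := by
    simp only [← Finset.mul_sum, ← Finset.sum_mul, dotProduct, trace, diag_apply]
  have h2 : ∑ i, ∑ j, w i * (A i j * w j) = w ⬝ᵥ A *ᵥ w := by
    simp only [← Finset.mul_sum, dotProduct, mulVec]
  have h3 : ∑ i, ∑ j, w j * (A j i * w i) = w ⬝ᵥ A *ᵥ w := by
    rw [Finset.sum_comm]; exact h2
  have h4 : ∑ i, ∑ j, w j * w j * A i i = (w ⬝ᵥ w) * A.trace := by
    rw [Finset.sum_comm]; exact h1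
  rw [h1, h2, h3, h4, horTrace]; ring

theorem horTrace_nonneg (hA : ∀ b, 0 ≤ b ⬝ᵥ A *ᵥ b) : 0 ≤ horTrace w A := by
  have := two_mul_horTrace w A
  have h2 : 0 ≤ 2 * horTrace w A := by
    rw [this]
    exact Finset.sum_nonneg fun i _ => Finset.sum_nonneg fun j _ => hA _
  linarith

theorem lagrange_identity (v : Fin n → ℝ) : 
    ∑ i, ∑ j, (w i * v j - w j * v i) ^ 2 = 2 * ((w ⬝ᵥ w) * (v ⬝ᵥ v) - (w ⬝ᵥ v) ^ 2) := by
  rw [← horTrace_vecMulVec, two_mul_horTrace]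
  refine Finset.sum_congr rfl fun i _ => Finset.sum_congr rfl fun j _ => ?_
  simp [mulVec_sub, sub_dotProduct, mulVec_smul, vecMulVec_apply]
  ring

theorem mul_eq_mul_of_lagrange_nonpos {v : Fin n → ℝ}
    (h : (w ⬝ᵥ w) * (v ⬝ᵥ v) - (w ⬝ᵥ v) ^ 2 ≤ 0) (i j : Fin n) : w i * v j = w j * v i := by
  have h0 := lagrange_identity w v
  have h1 : (w i * v j - w j * v i) ^ 2 ≤ ∑ i, ∑ j, (w i * v j - w j * v i) ^ 2 :=
    (Finset.single_le_sum (f := fun j => (w i * v j - w j * v i) ^ 2)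
      (fun _ _ => sq_nonneg _) (Finset.mem_univ j)).trans
    (Finset.single_le_sum (f := fun i => ∑ j, (w i * v j - w j * v i) ^ 2)
      (fun _ _ => Finset.sum_nonneg fun _ _ => sq_nonneg _) (Finset.mem_univ i))
  have h2 : (w i * v j - w j * v i) ^ 2 = 0 := le_antisymm (by linarith) (sq_nonneg _)
  have := pow_eq_zero_iff (two_ne_zero) |>.1 h2
  linarith

end horTrace

theorem continuousOn_horTrace {n : ℕ} {s : Set (Fin n → ℝ)} {w : (Fin n → ℝ) → (Fin n → ℝ)}
    {A : (Fin n → ℝ) → Matrix (Fin n) (Fin n) ℝ} (hw : ∀ i, ContinuousOn (fun x => w x i) s)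
    (hA : ∀ i j, ContinuousOn (fun x => A x i j) s) :
    ContinuousOn (fun x => horTrace (w x) (A x)) s := by
  simp only [horTrace, dotProduct, mulVec, trace, diag_apply]
  fun_prop

/-- Comparison with a test function `h` which is nonpositive on the zero set of a nonnegative
supersolution `φ`, vanishing at a point `z` of this set. -/
theorem JetOn.horTrace_le_of_touching {n : ℕ} {s : Set (Fin n → ℝ)} (hs : IsOpen s)
    {w : (Fin n → ℝ) → (Fin n → ℝ)} (hw : ∀ i, ContinuousOn (fun x => w x i) s)
    {φ h : (Fin n → ℝ) → ℝ} {gφ gh : (Fin n → ℝ) → (Fin n → ℝ)}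
    {Aφ Ah : (Fin n → ℝ) → Matrix (Fin n) (Fin n) ℝ}
    (Hφ : JetOn s φ gφ Aφ) (Hh : JetOn s h gh Ah) (hφ : ∀ x ∈ s, 0 ≤ φ x) {C : ℝ}
    (hsup : ∀ x ∈ s, horTrace (w x) (Aφ x) ≤ C * ‖gφ x‖) {z : Fin n → ℝ} (hz : z ∈ s)
    (hφz : φ z = 0) (hhz : h z = 0) (htouch : ∀ᶠ x in 𝓝 z, φ x = 0 → h x ≤ 0) :
    horTrace (w z) (Ah z) ≤ C * ‖gh z‖ := by
  by_contra! hlt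
  -- a strict version of the test function
  set f : (Fin n → ℝ) → ℝ := fun x =>
    h x + (-1) * ((x - z) ⬝ᵥ (1 : Matrix (Fin n) (Fin n) ℝ) *ᵥ (x - z)) ^ 2 with hf
  obtain ⟨gf, Af, Hf, hgf, hAf⟩ : ∃ gf Af, JetOn s f gf Af ∧ gf z = gh z ∧ Af z = Ah z := by
    refine ⟨_, _, Hh.add (((JetOn.quad (transpose_one) z).sq).const_mul (-1)), ?_, ?_⟩ <;> simp
  have hfz : f z = 0 := by simp [hf, hhz]
  have hc : ContinuousOn (fun x => horTrace (w x) (Af x) - C * ‖gf x‖) s :=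
    (continuousOn_horTrace hw Hf.contHess).sub
      (continuousOn_const.mul (continuousOn_pi.2 Hf.continuousOn_grad).norm)
  have hpos : ∀ᶠ x in 𝓝 z, 0 < horTrace (w x) (Af x) - C * ‖gf x‖ := by
    refine (hc.continuousAt (hs.mem_nhds hz)).eventually (lt_mem_nhds ?_)
    beta_reduce
    rw [hgf, hAf]; linarith
  obtain ⟨r, hr, hball⟩ := Metric.nhds_basis_closedBall.eventually_iff.1
    ((hpos.and htouch).and (hs.eventually_mem hz))
  have hsub : Metric.closedBall z r ⊆ s := fun x hx => (hball hx).2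
  have hfneg : ∀ x ∈ Metric.sphere z r, φ x = 0 → f x < 0 := by
    intro x hx h0
    have h1 := (hball (Metric.sphere_subset_closedBall hx)).1.2 h0
    have h2 : x - z ≠ 0 := by
      rintro h2
      rw [mem_sphere_iff_norm, h2, norm_zero] at hx
      linarith
    have h3 : 0 < (x - z) ⬝ᵥ (x - z) := by
      have := dotProduct_self_eq_zero.not.2 h2
      have h4 : 0 ≤ (x - z) ⬝ᵥ (x - z) := Finset.sum_nonneg fun _ _ => mul_self_nonneg _
      exact lt_of_le_of_ne h4 (Ne.symm this)
    have h4 : 0 < ((x - z) ⬝ᵥ (x - z)) ^ 2 := by positivity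
    simp only [hf, one_mulVec]
    linarith
  -- a small multiple of `f` lies below `φ` on the sphere
  obtain ⟨δ, hδ, hδs⟩ : ∃ δ > 0, ∀ x ∈ Metric.sphere z r, 0 < φ x + (-δ) * f x := by
    have hcs : IsCompact (Metric.sphere z r) := isCompact_sphere z r
    have hfc : ContinuousOn f (Metric.sphere z r) :=
      Hf.continuousOn.mono (Metric.sphere_subset_closedBall.trans hsub)
    have hφc : ContinuousOn φ (Metric.sphere z r) :=
      Hφ.continuousOn.mono (Metric.sphere_subset_closedBall.trans hsub)
    have hK : IsCompact (Metric.sphere z r ∩ f ⁻¹' Ici 0) :=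
      hcs.of_isClosed_subset (hfc.preimage_isClosed_of_isClosed hcs.isClosed isClosed_Ici)
        inter_subset_left
    obtain ⟨D, hD⟩ := hcs.exists_bound_of_continuousOn hfc
    rcases (Metric.sphere z r ∩ f ⁻¹' Ici 0).eq_empty_or_nonempty with he | hne
    · refine ⟨1, one_pos, fun x hx => ?_⟩
      have h1 : ¬ 0 ≤ f x := fun h1 => by
        have : x ∈ Metric.sphere z r ∩ f ⁻¹' Ici 0 := ⟨hx, h1⟩
        rw [he] at this; exact this
      have := hφ x (hsub (Metric.sphere_subset_closedBall hx))
      linarith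
    · obtain ⟨x₀, hx₀, hmin⟩ := hK.exists_isMinOn hne (hφc.mono inter_subset_left)
      have hc0 : 0 < φ x₀ := by
        refine lt_of_le_of_ne (hφ x₀ (hsub (Metric.sphere_subset_closedBall hx₀.1)))
          fun h0 => ?_
        have := hfneg x₀ hx₀.1 h0.symm
        exact absurd hx₀.2 (not_le.2 this)
      have hD0 : 0 ≤ D := (norm_nonneg _).trans (hD x₀ hx₀.1)
      refine ⟨φ x₀ / (D + 1), by positivity, fun x hx => ?_⟩
      have hφx := hφ x (hsub (Metric.sphere_subset_closedBall hx))
      by_cases h1 : 0 ≤ f x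
      · have h2 : φ x₀ ≤ φ x := hmin ⟨hx, h1⟩
        have h3 : f x ≤ D := (le_abs_self _).trans (hD x hx)
        have h4 : φ x₀ / (D + 1) * f x < φ x₀ := by
          rw [div_mul_eq_mul_div, div_lt_iff₀ (by positivity)]
          exact mul_lt_mul_of_pos_left (by linarith) hc0
        linarith
      · have : 0 < φ x₀ / (D + 1) := by positivity
        have := mul_neg_of_pos_of_neg this (not_le.1 h1)
        have h6 : f x < 0 := not_le.1 h1
        nlinarith
  have HF := Hφ.add (Hf.const_mul (-δ))
  obtain ⟨p, hp, hmin⟩ := (isCompact_closedBall z r).exists_isMinOn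
    ⟨z, Metric.mem_closedBall_self hr.le⟩ (HF.continuousOn.mono hsub)
  have hpz : φ p + (-δ) * f p ≤ 0 := by
    have : φ p + (-δ) * f p ≤ φ z + (-δ) * f z := hmin (Metric.mem_closedBall_self hr.le)
    rwa [hφz, hfz, mul_zero, add_zero] at this
  have hpb : p ∈ Metric.ball z r := by
    refine lt_of_le_of_ne (Metric.mem_closedBall.1 hp) fun h0 => ?_
    have := hδs p h0
    linarith
  have hloc : IsLocalMin (fun x => φ x + (-δ) * f x) p :=
    hmin.isLocalMin (mem_of_superset (Metric.isOpen_ball.mem_nhds hpb)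
      Metric.ball_subset_closedBall)
  have h1 := HF.grad_eq_zero_of_isLocalMin (hsub hp) hloc
  have h2 := horTrace_nonneg (w p) _ (HF.hess_nonneg_of_isLocalMin hs (hsub hp) hloc)
  rw [horTrace_add, horTrace_smul] at h2
  have h3 : gφ p = δ • gf p := by
    have : gφ p + (-δ) • gf p = 0 := h1
    rwa [neg_smul, add_neg_eq_zero] at this
  have h4 := hsup p (hsub hp)
  rw [h3, norm_smul, Real.norm_of_nonneg hδ.le] at h4
  have h5 := mul_pos hδ (hball hp).1.1
  nlinarith

/-- First and second order information on test functions touching the zero set of a nonnegative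
supersolution. -/
theorem JetOn.touching_conditions {n : ℕ} {s : Set (Fin n → ℝ)} (hs : IsOpen s)
    {w : (Fin n → ℝ) → (Fin n → ℝ)} (hw : ∀ i, ContinuousOn (fun x => w x i) s)
    {φ ψ : (Fin n → ℝ) → ℝ} {gφ gψ : (Fin n → ℝ) → (Fin n → ℝ)}
    {Aφ Aψ : (Fin n → ℝ) → Matrix (Fin n) (Fin n) ℝ}
    (Hφ : JetOn s φ gφ Aφ) (Hψ : JetOn s ψ gψ Aψ) (hφ : ∀ x ∈ s, 0 ≤ φ x) {C : ℝ}
    (hsup : ∀ x ∈ s, horTrace (w x) (Aφ x) ≤ C * ‖gφ x‖) {z : Fin n → ℝ} (hz : z ∈ s)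
    (hφz : φ z = 0) (htouch : ∀ᶠ x in 𝓝 z, φ x = 0 → ψ x ≤ ψ z) :
    horTrace (w z) (Aψ z) ≤ C * ‖gψ z‖ ∧
      ∀ i j, w z i * gψ z j = w z j * gψ z i := by
  have H1 := Hψ.add (JetOn.const (-ψ z))
  have hb : ∀ k : ℝ, 0 ≤ k → horTrace (w z) (Aψ z) +
      2 * k * ((w z ⬝ᵥ w z) * (gψ z ⬝ᵥ gψ z) - (w z ⬝ᵥ gψ z) ^ 2) ≤ C * ‖gψ z‖ := by
    intro k hk
    have H2 := H1.add (H1.sq.const_mul k)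
    have hcont : ContinuousAt (fun x => 1 + k * (ψ x + -ψ z)) z :=
      continuousAt_const.add (continuousAt_const.mul
        (((Hψ.hasGrad z hz).continuousAt).add continuousAt_const))
    have hev : ∀ᶠ x in 𝓝 z, 0 < 1 + k * (ψ x + -ψ z) :=
      hcont.eventually (lt_mem_nhds (by simp))
    have := JetOn.horTrace_le_of_touching hs hw Hφ H2 hφ hsup hz hφz (by simp) (by
      filter_upwards [htouch, hev] with x h1 h2 h3
      have := h1 h3
      nlinarith)
    simp only [add_neg_cancel, mul_zero, zero_smul, add_zero, zero_add, smul_zero,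
      horTrace_add, horTrace_smul, horTrace_vecMulVec] at this
    linarith
  refine ⟨by simpa using hb 0 le_rfl, mul_eq_mul_of_lagrange_nonpos _ ?_⟩
  by_contra! hpos
  set L := (w z ⬝ᵥ w z) * (gψ z ⬝ᵥ gψ z) - (w z ⬝ᵥ gψ z) ^ 2
  set D := C * ‖gψ z‖ - horTrace (w z) (Aψ z)
  have h1 := hb ((|D| + 1) / L) (by positivity)
  have h2 : 2 * ((|D| + 1) / L) * L = 2 * (|D| + 1) := by field_simp
  have := le_abs_self D
  have := abs_nonneg D
  linarith

theorem dotProduct_self_pos {n : ℕ} {w : Fin n → ℝ} (hw : w ≠ 0) : 0 < w ⬝ᵥ w :=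
  lt_of_le_of_ne (Finset.sum_nonneg fun _ _ => mul_self_nonneg _)
    (Ne.symm (dotProduct_self_eq_zero.not.2 hw))

theorem dotProduct_mulVec_transpose {n : ℕ} (A : Matrix (Fin n) (Fin n) ℝ) (a b : Fin n → ℝ) :
    a ⬝ᵥ A *ᵥ b = (Aᵀ *ᵥ a) ⬝ᵥ b := by
  rw [dotProduct_mulVec, mulVec_transpose]

theorem matrix_rank_add_le {n : ℕ} (A B : Matrix (Fin n) (Fin n) ℝ) :
    (A + B).rank ≤ A.rank + B.rank := by
  have h : LinearMap.range (A + B).mulVecLin ≤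
      LinearMap.range A.mulVecLin ⊔ LinearMap.range B.mulVecLin := by
    rintro _ ⟨x, rfl⟩
    rw [mulVecLin_add]
    exact Submodule.add_mem_sup ⟨x, rfl⟩ ⟨x, rfl⟩
  exact (Submodule.finrank_mono h).trans (Submodule.finrank_add_le_finrank_add_finrank _ _)

/-- A skew form of rank at least three has a nonzero compression to any hyperplane. -/
theorem exists_skew_compression {n : ℕ} {J : Matrix (Fin n) (Fin n) ℝ} (hJ : Jᵀ = -J)
    (hr : 3 ≤ J.rank) {w : Fin n → ℝ} (hw : w ≠ 0) :
    ∃ N : Matrix (Fin n) (Fin n) ℝ, Nᵀ = -N ∧ N *ᵥ w = 0 ∧ N ≠ 0 ∧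
      ∀ ζ, w ⬝ᵥ ζ = 0 → (J *ᵥ ζ) ⬝ᵥ (N *ᵥ ζ) = (N *ᵥ ζ) ⬝ᵥ (N *ᵥ ζ) := by
  have hww := dotProduct_self_pos hw
  set c : ℝ := (w ⬝ᵥ w)⁻¹ with hc
  have hcw : c * (w ⬝ᵥ w) = 1 := inv_mul_cancel₀ hww.ne'
  set R : Matrix (Fin n) (Fin n) ℝ := c • vecMulVec w w with hR
  set P : Matrix (Fin n) (Fin n) ℝ := 1 - R with hP
  have hRt : Rᵀ = R := by simp [hR, transpose_smul, transpose_vecMulVec]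
  have hPt : Pᵀ = P := by simp [hP, hRt]
  have hRR : R * R = R := by
    rw [hR, Matrix.smul_mul, Matrix.mul_smul, vecMulVec_mul_vecMulVec, vecMulVec_smul, smul_smul,
      smul_smul, mul_assoc, hcw, mul_one]
  have hPP : P * P = P := by
    simp [hP, mul_sub, sub_mul, hRR]
  have hRv : ∀ ζ, R *ᵥ ζ = (c * (w ⬝ᵥ ζ)) • w := fun ζ => by
    simp [hR, smul_mulVec, vecMulVec_mulVec, smul_smul]
  have hPw : P *ᵥ w = 0 := by
    simp [hP, sub_mulVec, hRv, hcw]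
  refine ⟨P * J * P, ?_, ?_, ?_, ?_⟩
  · simp [transpose_mul, hPt, hJ, mul_assoc]
  · simp [← mulVec_mulVec, hPw]
  · intro h0
    have hJR : J = R * (J * P) + J * R := by
      have : P * (J * P) = 0 := by rw [← mul_assoc]; exact h0
      have h1 : R * (J * P) = J * P := by
        have : (1 - R) * (J * P) = 0 := this
        rw [sub_mul, one_mul, sub_eq_zero] at this
        exact this.symm
      rw [h1, hP, mul_sub, mul_one, sub_add_cancel]
    have hRr : R.rank ≤ 1 := by
      have : R = vecMulVec (c • w) w := by rw [smul_vecMulVec]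
      rw [this]
      exact rank_vecMulVec_le _ _
    have h2 : J.rank ≤ 2 := by
      rw [hJR]
      exact (matrix_rank_add_le _ _).trans (add_le_add ((rank_mul_le_left _ _).trans hRr)
        ((rank_mul_le_right _ _).trans hRr))
    omega
  · intro ζ hζ
    have hPζ : P *ᵥ ζ = ζ := by simp [hP, sub_mulVec, hRv, hζ]
    have h1 : (P * J * P) *ᵥ ζ = P *ᵥ (J *ᵥ ζ) := by
      rw [← mulVec_mulVec, ← mulVec_mulVec, hPζ]
    rw [h1, dotProduct_mulVec_transpose P (P *ᵥ _), hPt, mulVec_mulVec _ P P, hPP,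
      dotProduct_mulVec_transpose P, hPt]

theorem exists_quadratic_bound {n : ℕ} (S : Matrix (Fin n) (Fin n) ℝ) :
    ∃ c : ℝ, ∀ ξ : Fin n → ℝ, ξ ⬝ᵥ S *ᵥ ξ ≤ c * (ξ ⬝ᵥ ξ) := by
  refine ⟨∑ i, ∑ j, |S i j|, fun ξ => ?_⟩
  have hsq : ∀ i, ξ i ^ 2 ≤ ξ ⬝ᵥ ξ := fun i => by
    have := Finset.single_le_sum (f := fun i => ξ i * ξ i) (fun _ _ => mul_self_nonneg _)
      (Finset.mem_univ i)
    rw [sq]; exact this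
  rw [Finset.sum_mul]
  refine Finset.sum_le_sum fun i _ => ?_
  rw [Finset.sum_mul]
  simp only [mulVec, dotProduct, Finset.mul_sum (a := ξ i)]
  refine Finset.sum_le_sum fun j _ => ?_
  have h1 : |ξ i * ξ j| ≤ ξ ⬝ᵥ ξ := by
    rw [abs_mul]
    have hi := hsq i
    have hj := hsq j
    rw [← sq_abs] at hi hj
    nlinarith [sq_nonneg (|ξ i| - |ξ j|)]
  calc ξ i * (S i j * ξ j) = S i j * (ξ i * ξ j) := by ring
    _ ≤ |S i j * (ξ i * ξ j)| := le_abs_self _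
    _ = |S i j| * |ξ i * ξ j| := abs_mul _ _
    _ ≤ _ := mul_le_mul_of_nonneg_left h1 (abs_nonneg _)

theorem dotProduct_skew_self {n : ℕ} {N : Matrix (Fin n) (Fin n) ℝ} (hN : Nᵀ = -N)
    (a : Fin n → ℝ) : (N *ᵥ a) ⬝ᵥ a = 0 := by
  have h := dotProduct_mulVec_transpose N a a
  rw [hN, neg_mulVec, neg_dotProduct, dotProduct_comm] at h
  linarith

theorem dotProduct_eq_zero_of_parallel {n : ℕ} {w e b : Fin n → ℝ} (hw : w ≠ 0)
    (h : ∀ i j, w i * e j = w j * e i) (hb : w ⬝ᵥ b = 0) : e ⬝ᵥ b = 0 := by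
  have h1 : (w ⬝ᵥ w) * (e ⬝ᵥ b) = (w ⬝ᵥ e) * (w ⬝ᵥ b) := by
    simp only [dotProduct, Finset.sum_mul_sum]
    refine Finset.sum_congr rfl fun i _ => Finset.sum_congr rfl fun j _ => ?_
    linear_combination w i * b j * h i j
  rw [hb, mul_zero] at h1
  exact (mul_eq_zero.1 h1).resolve_left (dotProduct_self_pos hw).ne'

theorem eq_zero_of_parallel {n : ℕ} {J N : Matrix (Fin n) (Fin n) ℝ} (hJ : Jᵀ = -J)
    (hN : Nᵀ = -N) {w ζ e : Fin n → ℝ} (hw : w ≠ 0) (hNw : N *ᵥ w = 0) (hwζ : w ⬝ᵥ ζ = 0)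
    (hJN : (J *ᵥ ζ) ⬝ᵥ (N *ᵥ ζ) = (N *ᵥ ζ) ⬝ᵥ (N *ᵥ ζ)) {α β c : ℝ} (hα : α ≠ 0) (hβ : β ≠ 0)
    (he : e = α • J *ᵥ ζ + β • ζ + c • (Nᵀ * N) *ᵥ ζ) (h : ∀ i j, w i * e j = w j * e i) :
    ζ = 0 := by
  have hwN : w ⬝ᵥ N *ᵥ ζ = 0 := by
    rw [dotProduct_mulVec_transpose, hN, neg_mulVec, hNw, neg_zero, zero_dotProduct]
  have h1 := dotProduct_eq_zero_of_parallel hw h hwN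
  have hG : (Nᵀ * N) *ᵥ ζ = -(N *ᵥ N *ᵥ ζ) := by
    rw [hN, ← mulVec_mulVec, neg_mulVec]
  rw [he, hG, add_dotProduct, add_dotProduct, smul_dotProduct, smul_dotProduct, smul_dotProduct,
    hJN, neg_dotProduct, dotProduct_skew_self hN, dotProduct_comm ζ, dotProduct_skew_self hN] at h1
  have hNζ : N *ᵥ ζ = 0 := by
    simp only [smul_eq_mul, mul_zero, neg_zero, add_zero] at h1
    exact dotProduct_self_eq_zero.1 ((mul_eq_zero.1 h1).resolve_left hα)
  have h2 := dotProduct_eq_zero_of_parallel hw h hwζ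
  rw [he, hG, hNζ, add_dotProduct, add_dotProduct, smul_dotProduct, smul_dotProduct,
    dotProduct_skew_self hJ] at h2
  simp only [smul_eq_mul, mul_zero, mulVec_zero, neg_zero, smul_zero, zero_dotProduct, zero_add,
    add_zero] at h2
  exact dotProduct_self_eq_zero.1 ((mul_eq_zero.1 h2).resolve_left hβ)

theorem horTrace_transpose_mul_self_pos {n : ℕ} {N : Matrix (Fin n) (Fin n) ℝ} {w : Fin n → ℝ}
    (hw : w ≠ 0) (hNw : N *ᵥ w = 0) (hN : N ≠ 0) : 0 < horTrace w (Nᵀ * N) := by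
  rw [horTrace, ← mulVec_mulVec, hNw, mulVec_zero, dotProduct_zero, sub_zero]
  refine mul_pos (dotProduct_self_pos hw) ?_
  have h1 := trace_conjTranspose_mul_self_eq_zero_iff (A := N)
  rw [conjTranspose_eq_transpose_of_trivial] at h1
  refine lt_of_le_of_ne ?_ (Ne.symm (h1.not.2 hN))
  simp only [trace, diag_apply, mul_apply, transpose_apply]
  exact Finset.sum_nonneg fun _ _ => Finset.sum_nonneg fun _ _ => mul_self_nonneg _

theorem sq_norm_le_dotProduct_self {n : ℕ} (ξ : Fin n → ℝ) : ‖ξ‖ ^ 2 ≤ ξ ⬝ᵥ ξ := by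
  have h0 : 0 ≤ ξ ⬝ᵥ ξ := Finset.sum_nonneg fun _ _ => mul_self_nonneg _
  have : ‖ξ‖ ≤ √(ξ ⬝ᵥ ξ) := by
    refine (pi_norm_le_iff_of_nonneg (Real.sqrt_nonneg _)).2 fun i => ?_
    refine Real.le_sqrt_of_sq_le ?_
    rw [Real.norm_eq_abs, sq_abs, sq]
    exact Finset.single_le_sum (f := fun i => ξ i * ξ i) (fun _ _ => mul_self_nonneg _)
      (Finset.mem_univ i)
  calc ‖ξ‖ ^ 2 ≤ √(ξ ⬝ᵥ ξ) ^ 2 := by gcongr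
    _ = _ := Real.sq_sqrt h0

/-- At each small scale `ε`, maximizing an anisotropic quartic polynomial over the zero set of a
supersolution yields a nearby point of the zero set at which the touching conditions hold. -/
theorem JetOn.exists_touching_at_scale {n : ℕ} {s : Set (Fin n → ℝ)} (hs : IsOpen s)
    {w : (Fin n → ℝ) → (Fin n → ℝ)} (hw : ∀ i, ContinuousOn (fun x => w x i) s)
    {φ : (Fin n → ℝ) → ℝ} {gφ : (Fin n → ℝ) → (Fin n → ℝ)}
    {Aφ : (Fin n → ℝ) → Matrix (Fin n) (Fin n) ℝ}
    (Hφ : JetOn s φ gφ Aφ) (hφ : ∀ x ∈ s, 0 ≤ φ x) {C : ℝ}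
    (hsup : ∀ x ∈ s, horTrace (w x) (Aφ x) ≤ C * ‖gφ x‖) {y : Fin n → ℝ}
    (hφy : φ y = 0) {p : Fin n → ℝ} {S G : Matrix (Fin n) (Fin n) ℝ}
    (hS : Sᵀ = S) (hG : Gᵀ = G) {c M : ℝ} (hc : ∀ ξ : Fin n → ℝ, ξ ⬝ᵥ S *ᵥ ξ ≤ c * (ξ ⬝ᵥ ξ))
    {T : Matrix (Fin n) (Fin n) ℝ} (hT : T = S - (c + 2) • 1 + M • G)
    {ε : ℝ} (hε : 0 < ε) (hball : Metric.closedBall y ε ⊆ s)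
    (hprox : ∀ x ∈ Metric.closedBall y ε, φ x = 0 →
      p ⬝ᵥ (x - y) ≤ 1 / 2 * ((x - y) ⬝ᵥ (x - y))) :
    ∃ ζ : Fin n → ℝ, ‖ζ‖ ≤ 1 ∧ p ⬝ᵥ ζ ≤ ε * (1 / 2 * (ζ ⬝ᵥ ζ)) ∧
      0 ≤ p ⬝ᵥ ζ + ε * (ζ ⬝ᵥ T *ᵥ ζ - (M ^ 2 + 1) * (ζ ⬝ᵥ G *ᵥ ζ) ^ 2) ∧
      (∀ i j, w (y + ε • ζ) i *
          (p + ε • ((2 : ℝ) • T *ᵥ ζ - (4 * (M ^ 2 + 1) * (ζ ⬝ᵥ G *ᵥ ζ)) • G *ᵥ ζ)) j =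
        w (y + ε • ζ) j *
          (p + ε • ((2 : ℝ) • T *ᵥ ζ - (4 * (M ^ 2 + 1) * (ζ ⬝ᵥ G *ᵥ ζ)) • G *ᵥ ζ)) i) ∧
      horTrace (w (y + ε • ζ)) ((2 : ℝ) • T - (4 * (M ^ 2 + 1) * (ζ ⬝ᵥ G *ᵥ ζ)) • G
          - (8 * (M ^ 2 + 1)) • vecMulVec (G *ᵥ ζ) (G *ᵥ ζ)) ≤
        C * ‖p + ε • ((2 : ℝ) • T *ᵥ ζ - (4 * (M ^ 2 + 1) * (ζ ⬝ᵥ G *ᵥ ζ)) • G *ᵥ ζ)‖ := by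
  have hTt : Tᵀ = T := by simp [hT, hS, hG]
  have Hψ := ((JetOn.linear (s := s) p y).add (JetOn.quad hTt y)).add
    (((JetOn.quad hG y).sq).const_mul (-((M ^ 2 + 1) / ε ^ 2)))
  set ψ : (Fin n → ℝ) → ℝ := fun x => p ⬝ᵥ (x - y) + (x - y) ⬝ᵥ T *ᵥ (x - y) +
    -((M ^ 2 + 1) / ε ^ 2) * ((x - y) ⬝ᵥ G *ᵥ (x - y)) ^ 2 with hψ
  have hyb : y ∈ Metric.closedBall y ε := Metric.mem_closedBall_self hε.le
  have hK : IsCompact (Metric.closedBall y ε ∩ φ ⁻¹' {0}) :=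
    (isCompact_closedBall y ε).of_isClosed_subset
      ((Hφ.continuousOn.mono hball).preimage_isClosed_of_isClosed Metric.isClosed_closedBall
        isClosed_singleton) inter_subset_left
  obtain ⟨x, ⟨hxb, hxφ⟩, hmax⟩ := hK.exists_isMaxOn ⟨y, hyb, hφy⟩
    (Hψ.continuousOn.mono (inter_subset_left.trans hball))
  have hxφ : φ x = 0 := hxφ
  have hψx : 0 ≤ ψ x := by
    have : ψ y ≤ ψ x := hmax ⟨hyb, hφy⟩
    simpa [hψ] using this
  have hpx := hprox x hxb hxφ
  have hxlt : x ∈ Metric.ball y ε := by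
    refine lt_of_le_of_ne (Metric.mem_closedBall.1 hxb) fun h0 => ?_
    rw [dist_eq_norm] at h0
    have h1 := sq_norm_le_dotProduct_self (x - y)
    rw [h0] at h1
    have h2 := hc (x - y)
    have h3 : (x - y) ⬝ᵥ T *ᵥ (x - y) = (x - y) ⬝ᵥ S *ᵥ (x - y)
        - (c + 2) * ((x - y) ⬝ᵥ (x - y)) + M * ((x - y) ⬝ᵥ G *ᵥ (x - y)) := by
      simp [hT, add_mulVec, sub_mulVec, smul_mulVec]
    have h4 : ∃ t, (x - y) ⬝ᵥ G *ᵥ (x - y) = ε ^ 2 * t :=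
      ⟨(x - y) ⬝ᵥ G *ᵥ (x - y) / ε ^ 2, by field_simp⟩
    obtain ⟨t, ht⟩ := h4
    simp only [hψ, h3, ht] at hψx
    have h5 : -((M ^ 2 + 1) / ε ^ 2) * (ε ^ 2 * t) ^ 2 = -ε ^ 2 * ((M ^ 2 + 1) * t ^ 2) := by
      field_simp
    rw [h5] at hψx
    have h6 : M * t ≤ 1 + (M ^ 2 + 1) * t ^ 2 := by
      nlinarith [sq_nonneg (M * t - 1), sq_nonneg t, sq_nonneg (M * t)]
    have h7 : 0 < ε ^ 2 := by positivity
    nlinarith [mul_le_mul_of_nonneg_left h6 h7.le]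
  have htouch : ∀ᶠ x' in 𝓝 x, φ x' = 0 → ψ x' ≤ ψ x := by
    filter_upwards [Metric.isOpen_ball.mem_nhds hxlt] with x' h1 h2
    exact hmax ⟨Metric.ball_subset_closedBall h1, h2⟩
  obtain ⟨hd, hcc⟩ := JetOn.touching_conditions hs hw Hφ Hψ hφ hsup (hball hxb) hxφ htouch
  obtain ⟨ζ, hζ⟩ : ∃ ζ, x - y = ε • ζ := ⟨ε⁻¹ • (x - y), by rw [smul_inv_smul₀ hε.ne']⟩
  have hxy : x = y + ε • ζ := by rw [← hζ]; abel
  have eg : p + (2 : ℝ) • T *ᵥ (x - y) + (-((M ^ 2 + 1) / ε ^ 2)) •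
      ((2 * ((x - y) ⬝ᵥ G *ᵥ (x - y))) • ((2 : ℝ) • G *ᵥ (x - y))) =
      p + ε • ((2 : ℝ) • T *ᵥ ζ - (4 * (M ^ 2 + 1) * (ζ ⬝ᵥ G *ᵥ ζ)) • G *ᵥ ζ) := by
    ext i
    simp only [hζ, mulVec_smul, dotProduct_smul, smul_dotProduct, Pi.add_apply, Pi.smul_apply,
      Pi.sub_apply, smul_eq_mul]
    field_simp
    ring
  have eA : 0 + (2 : ℝ) • T + (-((M ^ 2 + 1) / ε ^ 2)) •
      ((2 * ((x - y) ⬝ᵥ G *ᵥ (x - y))) • ((2 : ℝ) • G) + (2 : ℝ) •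
        vecMulVec ((2 : ℝ) • G *ᵥ (x - y)) ((2 : ℝ) • G *ᵥ (x - y))) =
      (2 : ℝ) • T - (4 * (M ^ 2 + 1) * (ζ ⬝ᵥ G *ᵥ ζ)) • G
          - (8 * (M ^ 2 + 1)) • vecMulVec (G *ᵥ ζ) (G *ᵥ ζ) := by
    ext i j
    simp only [hζ, mulVec_smul, dotProduct_smul, smul_dotProduct, Matrix.add_apply,
      Matrix.smul_apply, Matrix.sub_apply, smul_eq_mul, vecMulVec_apply, Pi.smul_apply,
      Matrix.zero_apply]
    field_simp
    ring
  rw [eg, eA] at hd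
  rw [eg] at hcc
  rw [hxy] at hd hcc
  refine ⟨ζ, ?_, ?_, ?_, hcc, hd⟩
  · have := Metric.mem_closedBall.1 hxb
    rw [dist_eq_norm, hζ, norm_smul, Real.norm_of_nonneg hε.le] at this
    exact le_of_mul_le_mul_left (by linarith) hε
  · simp only [hζ, dotProduct_smul, smul_dotProduct, smul_eq_mul] at hpx
    refine le_of_mul_le_mul_left (hpx.trans_eq ?_) hε
    ring
  · simp only [hψ, hζ, dotProduct_smul, smul_dotProduct, mulVec_smul, smul_eq_mul] at hψx
    refine le_of_mul_le_mul_left ?_ hε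
    rw [mul_zero]
    refine hψx.trans_eq ?_
    field_simp
    ring

/-- If the differential of the covector field `w` has skew part of rank at least three, the zero
set of a nonnegative supersolution has no exterior ball with characteristic normal. -/
theorem JetOn.not_proximal_normal {n : ℕ} {s : Set (Fin n → ℝ)} (hs : IsOpen s)
    {w : (Fin n → ℝ) → (Fin n → ℝ)} (hw : ∀ i, ContinuousOn (fun x => w x i) s)
    {φ : (Fin n → ℝ) → ℝ} {gφ : (Fin n → ℝ) → (Fin n → ℝ)}
    {Aφ : (Fin n → ℝ) → Matrix (Fin n) (Fin n) ℝ}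
    (Hφ : JetOn s φ gφ Aφ) (hφ : ∀ x ∈ s, 0 ≤ φ x) {C : ℝ}
    (hsup : ∀ x ∈ s, horTrace (w x) (Aφ x) ≤ C * ‖gφ x‖) {y : Fin n → ℝ} (hy : y ∈ s)
    (hφy : φ y = 0) (hwy : w y ≠ 0) {B : Matrix (Fin n) (Fin n) ℝ}
    (hB : ∀ i, HasFDerivAt (fun x => w x i) (dotCLM (B i)) y) (hr : 3 ≤ (B - Bᵀ).rank)
    {τ : ℝ} (hτ : τ ≠ 0)
    (hprox : ∀ᶠ x in 𝓝 y, φ x = 0 → (τ • w y) ⬝ᵥ (x - y) ≤ 1 / 2 * ((x - y) ⬝ᵥ (x - y))) :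
    False := by
  set J := B - Bᵀ with hJ
  have hJt : Jᵀ = -J := by simp [hJ]
  obtain ⟨N, hN, hNw, hN0, hJN⟩ := exists_skew_compression hJt hr hwy
  set S : Matrix (Fin n) (Fin n) ℝ := (τ / 4) • (B + Bᵀ) with hSdef
  have hS : Sᵀ = S := by simp [hSdef, add_comm]
  set G := Nᵀ * N with hGdef
  have hG : Gᵀ = G := by simp [hGdef, transpose_mul]
  obtain ⟨c₀, hc₀⟩ := exists_quadratic_bound S
  obtain ⟨c, hc0, hc⟩ : ∃ c : ℝ, 0 ≤ c ∧ ∀ ξ : Fin n → ℝ, ξ ⬝ᵥ S *ᵥ ξ ≤ c * (ξ ⬝ᵥ ξ) := by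
    refine ⟨|c₀|, abs_nonneg _, fun ξ => (hc₀ ξ).trans ?_⟩
    exact mul_le_mul_of_nonneg_right (le_abs_self _)
      (Finset.sum_nonneg fun _ _ => mul_self_nonneg _)
  have hpos : 0 < horTrace (w y) G := horTrace_transpose_mul_self_pos hwy hNw hN0
  obtain ⟨M, hM⟩ : ∃ M : ℝ, C * ‖τ • w y‖ <
      horTrace (w y) ((2 : ℝ) • (S - (c + 2) • 1 + M • G)) := by
    have e : ∀ M : ℝ, horTrace (w y) ((2 : ℝ) • (S - (c + 2) • 1 + M • G)) =
        2 * (horTrace (w y) (S - (c + 2) • 1) + M * horTrace (w y) G) := fun M => by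
      rw [horTrace_smul, horTrace_add, horTrace_smul]
    refine ⟨(C * ‖τ • w y‖ / 2 + 1 - horTrace (w y) (S - (c + 2) • 1)) / horTrace (w y) G, ?_⟩
    rw [e, div_mul_cancel₀ _ hpos.ne']
    linarith
  set T : Matrix (Fin n) (Fin n) ℝ := S - (c + 2) • 1 + M • G with hT
  obtain ⟨r, hr0, hball⟩ := Metric.nhds_basis_closedBall.eventually_iff.1
    (hprox.and (hs.eventually_mem hy))
  set ε : ℕ → ℝ := fun k => r * (1 / ((k : ℝ) + 1)) with hεdef
  have hε : ∀ k, 0 < ε k := fun k => by positivity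
  have hεr : ∀ k, ε k ≤ r := fun k => by
    have h1 : 1 / ((k : ℝ) + 1) ≤ 1 := by
      rw [div_le_one (by positivity)]
      have : (0 : ℝ) ≤ k := by positivity
      linarith
    exact mul_le_of_le_one_right hr0.le h1
  have hε0 : Tendsto ε atTop (𝓝 0) := by
    have := (tendsto_one_div_add_atTop_nhds_zero_nat (𝕜 := ℝ)).const_mul r
    rwa [mul_zero] at this
  have key := fun k => JetOn.exists_touching_at_scale hs hw Hφ hφ hsup hφy (p := τ • w y)
    hS hG hc hT (hε k)
    (fun x hx => (hball (Metric.closedBall_subset_closedBall (hεr k) hx)).2)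
    (fun x hx => (hball (Metric.closedBall_subset_closedBall (hεr k) hx)).1)
  choose ζ h1 h2 h3 h4 h5 using key
  obtain ⟨η, -, θ, hθ, hlim⟩ := (isCompact_closedBall (0 : Fin n → ℝ) 1).tendsto_subseq
    (x := ζ) (fun k => by simpa using h1 k)
  have hεθ : Tendsto (fun k => ε (θ k)) atTop (𝓝 0) := hε0.comp hθ.tendsto_atTop
  have hlim : Tendsto (fun k => ζ (θ k)) atTop (𝓝 η) := hlim
  have hcomp : ∀ f : (Fin n → ℝ) → ℝ, Continuous f →
      Tendsto (fun k => f (ζ (θ k))) atTop (𝓝 (f η)) := fun f hf =>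
    (hf.tendsto η).comp hlim
  have hstep : Tendsto (fun k => ε (θ k) • ζ (θ k)) atTop (𝓝 0) := by
    simpa using hεθ.smul hlim
  have hshift : Tendsto (fun k => y + ε (θ k) • ζ (θ k)) atTop (𝓝 y) := by
    simpa using hstep.const_add y
  have hwlim : ∀ i, Tendsto (fun k => w (y + ε (θ k) • ζ (θ k)) i) atTop (𝓝 (w y i)) := fun i =>
    ((hB i).continuousAt.tendsto).comp hshift
  -- the limit direction is horizontal
  have hpη : (τ • w y) ⬝ᵥ η = 0 := by
    have hp := hcomp (fun ζ => (τ • w y) ⬝ᵥ ζ) (by simp only [dotProduct]; fun_prop)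
    refine le_antisymm ?_ ?_
    · have hq := hεθ.mul (hcomp (fun ζ => 1 / 2 * (ζ ⬝ᵥ ζ)) (by simp only [dotProduct]; fun_prop))
      rw [zero_mul] at hq
      exact le_of_tendsto_of_tendsto' hp hq fun k => h2 (θ k)
    · have hq := hp.add (hεθ.mul (hcomp
        (fun ζ => ζ ⬝ᵥ T *ᵥ ζ - (M ^ 2 + 1) * (ζ ⬝ᵥ G *ᵥ ζ) ^ 2)
        (by simp only [dotProduct, mulVec]; fun_prop)))
      rw [zero_mul, add_zero] at hq
      exact ge_of_tendsto' hq fun k => h3 (θ k)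
  have hwη : w y ⬝ᵥ η = 0 := by
    rw [smul_dotProduct, smul_eq_mul] at hpη
    exact (mul_eq_zero.1 hpη).resolve_left hτ
  set γ : (Fin n → ℝ) → (Fin n → ℝ) := fun ζ =>
    (2 : ℝ) • T *ᵥ ζ - (4 * (M ^ 2 + 1) * (ζ ⬝ᵥ G *ᵥ ζ)) • G *ᵥ ζ with hγ
  have hγc : ∀ i, Continuous fun ζ => γ ζ i := fun i => by
    simp only [hγ, dotProduct, mulVec, Pi.sub_apply, Pi.smul_apply, smul_eq_mul]
    fun_prop
  -- the first order conditions in the limit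
  have hquot : ∀ i, Tendsto
      (fun k => (ε (θ k))⁻¹ * (w (y + ε (θ k) • ζ (θ k)) i - w y i)) atTop
      (𝓝 ((B *ᵥ η) i)) := fun i => by
    have := (hB i).hasFDerivWithinAt (s := univ) |>.lim (l := atTop)
      (c := fun k => (ε (θ k))⁻¹) (d := fun k => ε (θ k) • ζ (θ k)) (v := η)
      hstep (by simp)
      (hlim.congr fun k => by rw [inv_smul_smul₀ (hε _).ne'])
    rw [dotCLM_apply] at this
    exact this
  have hpar : ∀ i j, w y i * (γ η - τ • B *ᵥ η) j = w y j * (γ η - τ • B *ᵥ η) i := by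
    intro i j
    have l : ∀ i j, Tendsto (fun k => w (y + ε (θ k) • ζ (θ k)) i * γ (ζ (θ k)) j +
        (ε (θ k))⁻¹ * (w (y + ε (θ k) • ζ (θ k)) i - w y i) * (τ * w y j)) atTop
        (𝓝 (w y i * γ η j + (B *ᵥ η) i * (τ * w y j))) := fun i j =>
      ((hwlim i).mul (hcomp _ (hγc j))).add ((hquot i).mul_const _)
    have := tendsto_nhds_unique (l i j) ((l j i).congr fun k => ?_)
    · simp only [Pi.sub_apply, Pi.smul_apply, smul_eq_mul]
      linear_combination this
    · have h7 := h4 (θ k) i j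
      change _ * (τ • w y + ε (θ k) • γ (ζ (θ k))) j =
        _ * (τ • w y + ε (θ k) • γ (ζ (θ k))) i at h7
      simp only [Pi.add_apply, Pi.smul_apply, smul_eq_mul] at h7
      have h8 := (hε (θ k)).ne'
      field_simp
      linear_combination -h7
  have hη : η = 0 := by
    refine eq_zero_of_parallel hJt hN hwy hNw hwη (hJN η hwη) (α := -(τ / 2))
      (β := -(2 * (c + 2))) (c := 2 * M - 4 * (M ^ 2 + 1) * (η ⬝ᵥ G *ᵥ η))
      (by simpa using hτ) (by linarith) ?_ hpar
    ext i
    simp only [hγ, hT, hSdef, hJ, add_mulVec, sub_mulVec, smul_mulVec, one_mulVec,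
      Pi.add_apply, Pi.sub_apply, Pi.smul_apply, smul_eq_mul]
    ring
  -- the second order condition in the limit
  have hA : Tendsto (fun k => horTrace (w (y + ε (θ k) • ζ (θ k)))
      ((2 : ℝ) • T - (4 * (M ^ 2 + 1) * (ζ (θ k) ⬝ᵥ G *ᵥ ζ (θ k))) • G
          - (8 * (M ^ 2 + 1)) • vecMulVec (G *ᵥ ζ (θ k)) (G *ᵥ ζ (θ k)))) atTop
      (𝓝 (horTrace (w y) ((2 : ℝ) • T))) := by
    have hcont : Continuous fun q : (Fin n → ℝ) × (Fin n → ℝ) => horTrace q.1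
        ((2 : ℝ) • T - (4 * (M ^ 2 + 1) * (q.2 ⬝ᵥ G *ᵥ q.2)) • G
          - (8 * (M ^ 2 + 1)) • vecMulVec (G *ᵥ q.2) (G *ᵥ q.2)) := by
      simp only [horTrace, dotProduct, mulVec, trace, diag_apply, Matrix.sub_apply,
        Matrix.smul_apply, vecMulVec_apply, smul_eq_mul]
      fun_prop
    have := (hcont.tendsto (w y, η)).comp ((tendsto_pi_nhds.2 hwlim).prodMk_nhds hlim)
    simp only [hη, mulVec_zero, dotProduct_zero, mul_zero, zero_smul, sub_zero, vecMulVec_zero,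
      smul_zero] at this
    exact this
  have hC : Tendsto (fun k => C * ‖τ • w y + ε (θ k) • γ (ζ (θ k))‖) atTop
      (𝓝 (C * ‖τ • w y‖)) := by
    have h6 : Tendsto (fun k => γ (ζ (θ k))) atTop (𝓝 (γ η)) :=
      tendsto_pi_nhds.2 fun i => hcomp _ (hγc i)
    have := ((hεθ.smul h6).const_add (τ • w y)).norm.const_mul C
    simpa using this
  exact absurd hM (not_lt.2 (le_of_tendsto_of_tendsto' hA hC fun k => h5 (θ k)))

/-- The zero set of a nonnegative supersolution is open when `w` has a differential with skew part
of rank at least three. -/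
theorem JetOn.eventually_eq_zero {n : ℕ} {s : Set (Fin n → ℝ)} (hs : IsOpen s)
    {w : (Fin n → ℝ) → (Fin n → ℝ)} (hw0 : ∀ x ∈ s, w x ≠ 0)
    {φ : (Fin n → ℝ) → ℝ} {gφ : (Fin n → ℝ) → (Fin n → ℝ)}
    {Aφ B : (Fin n → ℝ) → Matrix (Fin n) (Fin n) ℝ}
    (Hφ : JetOn s φ gφ Aφ) (hφ : ∀ x ∈ s, 0 ≤ φ x) {C : ℝ}
    (hsup : ∀ x ∈ s, horTrace (w x) (Aφ x) ≤ C * ‖gφ x‖)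
    (hB : ∀ x ∈ s, ∀ i, HasFDerivAt (fun x => w x i) (dotCLM (B x i)) x)
    (hr : ∀ x ∈ s, 3 ≤ (B x - (B x)ᵀ).rank) {p : Fin n → ℝ} (hp : p ∈ s) (hφp : φ p = 0) :
    ∀ᶠ x in 𝓝 p, φ x = 0 := by
  have hw : ∀ i, ContinuousOn (fun x => w x i) s := fun i x hx =>
    (hB x hx i).continuousAt.continuousWithinAt
  obtain ⟨R, hR, hball⟩ := Metric.nhds_basis_closedBall.mem_iff.1 (hs.mem_nhds hp)
  have hK : IsCompact (Metric.closedBall p R ∩ φ ⁻¹' {0}) :=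
    (isCompact_closedBall p R).of_isClosed_subset
      ((Hφ.continuousOn.mono hball).preimage_isClosed_of_isClosed Metric.isClosed_closedBall
        isClosed_singleton) inter_subset_left
  have hdist : ∀ q : Fin n → ℝ, Continuous fun x => (x - q) ⬝ᵥ (x - q) := fun q => by
    simp only [dotProduct, Pi.sub_apply]
    fun_prop
  have hsmall : ∀ᶠ q in 𝓝 p, (q - p) ⬝ᵥ (q - p) < (R / 2) ^ 2 :=
    ((hdist p).tendsto p).eventually (gt_mem_nhds (by simp; positivity))
  have hnorm : ∀ ξ : Fin n → ℝ, ξ ⬝ᵥ ξ < (R / 2) ^ 2 → ‖ξ‖ < R / 2 := fun ξ hξ =>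
    lt_of_pow_lt_pow_left₀ 2 (by positivity) ((sq_norm_le_dotProduct_self ξ).trans_lt hξ)
  filter_upwards [hsmall] with q hq
  by_contra hφq
  obtain ⟨y, ⟨hyb, hyφ⟩, hmin⟩ := hK.exists_isMinOn
    ⟨p, Metric.mem_closedBall_self hR.le, hφp⟩ (hdist q).continuousOn
  have hyφ : φ y = 0 := hyφ
  have hyq : (y - q) ⬝ᵥ (y - q) < (R / 2) ^ 2 := by
    have h1 : (y - q) ⬝ᵥ (y - q) ≤ (p - q) ⬝ᵥ (p - q) :=
      hmin ⟨Metric.mem_closedBall_self hR.le, hφp⟩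
    have h2 : (p - q) ⬝ᵥ (p - q) = (q - p) ⬝ᵥ (q - p) := by
      rw [← neg_sub q p, neg_dotProduct_neg]
    linarith
  have hyR : y ∈ Metric.ball p R := by
    rw [mem_ball_iff_norm]
    calc ‖y - p‖ = ‖(y - q) + (q - p)‖ := by rw [sub_add_sub_cancel]
      _ ≤ ‖y - q‖ + ‖q - p‖ := norm_add_le _ _
      _ < R := by linarith [hnorm _ hyq, hnorm _ hq]
  have hys : y ∈ s := hball hyb
  have hnear : ∀ᶠ x in 𝓝 y, φ x = 0 → (y - q) ⬝ᵥ (y - q) ≤ (x - q) ⬝ᵥ (x - q) := by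
    filter_upwards [Metric.isOpen_ball.mem_nhds hyR] with x h1 h2
    exact hmin ⟨Metric.ball_subset_closedBall h1, h2⟩
  have Hψ := (JetOn.quad (s := s) (transpose_one (n := Fin n) (α := ℝ)) q).const_mul (-1)
  obtain ⟨-, hpar⟩ := JetOn.touching_conditions hs hw Hφ Hψ hφ hsup hys hyφ (by
    filter_upwards [hnear] with x h1 h2
    simp only [one_mulVec]
    linarith [h1 h2])
  simp only [one_mulVec, Pi.smul_apply, smul_eq_mul, Pi.sub_apply] at hpar
  obtain ⟨i, hi⟩ := Function.ne_iff.1 (hw0 y hys)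
  have hi : w y i ≠ 0 := hi
  set τ : ℝ := (q i - y i) / w y i with hτ
  have hτw : τ • w y = q - y := by
    ext j
    simp only [hτ, Pi.smul_apply, smul_eq_mul, Pi.sub_apply]
    field_simp
    linear_combination (1 / 2) * hpar j i
  refine JetOn.not_proximal_normal hs hw Hφ hφ hsup hys hyφ (hw0 y hys) (hB y hys) (hr y hys)
    (τ := τ) ?_ ?_
  · intro h0
    rw [h0, zero_smul] at hτw
    rw [sub_eq_zero.1 hτw.symm] at hφq
    exact hφq hyφ
  · filter_upwards [hnear] with x h1 h2
    have h3 := h1 h2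
    have h4 : x - q = (x - y) - (q - y) := by abel
    have h5 : y - q = -(q - y) := by abel
    rw [hτw]
    rw [h4, h5, neg_dotProduct_neg] at h3
    generalize x - y = a at h3 ⊢
    generalize q - y = b at h3 ⊢
    rw [sub_dotProduct, dotProduct_sub, dotProduct_sub, dotProduct_comm a b] at h3
    linarith

/-- `|w|² tr A - wᵀ A w` normalized by `|w|³` is locally Lipschitz in `(w, A)` away from
`w = 0`. -/
theorem exists_lipschitzOnWith_horTrace_div {n : ℕ} {w : Fin n → ℝ} (hw : w ≠ 0)
    (A : Fin n → Fin n → ℝ) :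
    ∃ K : NNReal, ∃ t ∈ 𝓝 (w, A), LipschitzOnWith K
      (fun q : (Fin n → ℝ) × (Fin n → Fin n → ℝ) =>
        horTrace q.1 (Matrix.of q.2) / √(q.1 ⬝ᵥ q.1) ^ 3) t := by
  suffices h : ContDiffAt ℝ 1 (fun q : (Fin n → ℝ) × (Fin n → Fin n → ℝ) =>
      horTrace q.1 (Matrix.of q.2) / √(q.1 ⬝ᵥ q.1) ^ 3) (w, A) from h.exists_lipschitzOnWith
  have hpos := dotProduct_self_pos hw
  have h1 : ContDiffAt ℝ 1 (fun q : (Fin n → ℝ) × (Fin n → Fin n → ℝ) => q.1 ⬝ᵥ q.1) (w, A) := by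
    simp only [dotProduct]
    fun_prop
  have h2 : ContDiffAt ℝ 1 (fun q : (Fin n → ℝ) × (Fin n → Fin n → ℝ) =>
      horTrace q.1 (Matrix.of q.2)) (w, A) := by
    simp only [horTrace, dotProduct, mulVec, trace, diag_apply, Matrix.of_apply]
    fun_prop
  exact h2.div ((h1.sqrt hpos.ne').pow 3) (pow_ne_zero 3 (Real.sqrt_pos.2 hpos).ne')

theorem ee_eq_single {n : ℕ} (i : Fin n) : ee n i = Pi.single i 1 := by
  ext j
  simp [ee, Pi.single_apply, Fin.ext_iff]

theorem hasFDerivAt_dotCLM_pd {n : ℕ} {f : (Fin n → ℝ) → ℝ} {x : Fin n → ℝ}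
    (hf : DifferentiableAt ℝ f x) : HasFDerivAt f (dotCLM fun i => pd n i f x) x := by
  refine hf.hasFDerivAt.congr_fderiv (ContinuousLinearMap.coe_injective ?_)
  refine (Pi.basisFun ℝ (Fin n)).ext fun i => ?_
  simp [dotCLM_apply, pd, ee_eq_single]

theorem pd_eq_of_hasFDerivAt {n : ℕ} {f : (Fin n → ℝ) → ℝ} {x a : Fin n → ℝ}
    (hf : HasFDerivAt f (dotCLM a) x) (i : Fin n) : pd n i f x = a i := by
  simp [pd, hf.fderiv, dotCLM_apply, ee_eq_single]

/-- The matrix of first partial derivatives of `∇u + F`. -/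
def jacF (n : ℕ) (F : (Fin n → ℝ) → (Fin n → ℝ)) (u : (Fin n → ℝ) → ℝ) (x : Fin n → ℝ) :
    Matrix (Fin n) (Fin n) ℝ :=
  Matrix.of fun i j => pd n j (fun y => gradF n F u y i) x

section

variable {n : ℕ} {U : Set (Fin n → ℝ)} {F : (Fin n → ℝ) → (Fin n → ℝ)} {u : (Fin n → ℝ) → ℝ}

theorem contDiffOn_pd (hU : IsOpen U) (hu : ContDiffOn ℝ 2 u U) (k : ℕ) :
    ContDiffOn ℝ 1 (fun x => pd n k u x) U :=
  (hu.fderiv_of_isOpen hU (by norm_num)).clm_apply contDiffOn_const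

theorem contDiffOn_gradF (hU : IsOpen U) (hF : ContDiffOn ℝ 1 F U) (hu : ContDiffOn ℝ 2 u U)
    (i : Fin n) : ContDiffOn ℝ 1 (fun x => gradF n F u x i) U :=
  (contDiffOn_pd hU hu i).add (contDiffOn_pi.1 hF i)

theorem hasFDerivAt_gradF (hU : IsOpen U) (hF : ContDiffOn ℝ 1 F U) (hu : ContDiffOn ℝ 2 u U)
    {x : Fin n → ℝ} (hx : x ∈ U) (i : Fin n) :
    HasFDerivAt (fun y => gradF n F u y i) (dotCLM (jacF n F u x i)) x :=
  hasFDerivAt_dotCLM_pd (((contDiffOn_gradF hU hF hu i).contDiffAt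
    (hU.mem_nhds hx)).differentiableAt one_ne_zero)

theorem continuousOn_jacF (hU : IsOpen U) (hF : ContDiffOn ℝ 1 F U) (hu : ContDiffOn ℝ 2 u U)
    (i j : Fin n) : ContinuousOn (fun x => jacF n F u x i j) U :=
  ((contDiffOn_gradF hU hF hu i).continuousOn_fderiv_of_isOpen hU le_rfl).clm_apply
    continuousOn_const

theorem jacF_sub_transpose (hU : IsOpen U) (hF : ContDiffOn ℝ 1 F U) (hu : ContDiffOn ℝ 2 u U)
    {x : Fin n → ℝ} (hx : x ∈ U) :
    jacF n F u x - (jacF n F u x)ᵀ = (curlMatrix n F x)ᵀ := by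
  have hd : ∀ i : Fin n, DifferentiableAt ℝ (fun y => pd n i u y) x := fun i =>
    ((contDiffOn_pd hU hu i).contDiffAt (hU.mem_nhds hx)).differentiableAt one_ne_zero
  have hFd : ∀ i : Fin n, DifferentiableAt ℝ (fun y => F y i) x := fun i =>
    ((contDiffOn_pi.1 hF i).contDiffAt (hU.mem_nhds hx)).differentiableAt one_ne_zero
  have h1 : ∀ i j : Fin n, jacF n F u x i j =
      pd n j (fun y => pd n i u y) x + pd n j (fun y => F y i) x := fun i j => by
    simp only [jacF, Matrix.of_apply, gradF]
    exact congrArg (fun L => L (ee n j)) (fderiv_fun_add (hd i) (hFd i))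
  have h2 : ∀ i j : Fin n, pd n j (fun y => pd n i u y) x =
      fderiv ℝ (fderiv ℝ u) x (ee n j) (ee n i) := fun i j => by
    have hdd : DifferentiableAt ℝ (fderiv ℝ u) x :=
      ((hu.fderiv_of_isOpen hU (m := 1) (by norm_num)).contDiffAt
        (hU.mem_nhds hx)).differentiableAt one_ne_zero
    change fderiv ℝ (fun y => fderiv ℝ u y (ee n i)) x (ee n j) = _
    rw [fderiv_clm_apply hdd (differentiableAt_const _)]
    simp
  have h3 : IsSymmSndFDerivAt ℝ u x :=
    (hu.contDiffAt (hU.mem_nhds hx)).isSymmSndFDerivAt (by simp)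
  ext i j
  simp only [Matrix.sub_apply, transpose_apply, h1, h2, curlMatrix, Matrix.of_apply]
  rw [h3 (ee n j) (ee n i)]
  ring

theorem Hmc_eq (hU : IsOpen U) (hF : ContDiffOn ℝ 1 F U) (hu : ContDiffOn ℝ 2 u U)
    {x : Fin n → ℝ} (hx : x ∈ U) (hns : gradF n F u x ≠ 0) :
    Hmc n F u x = horTrace (gradF n F u x) (jacF n F u x) /
      √(gradF n F u x ⬝ᵥ gradF n F u x) ^ 3 := by
  set w := gradF n F u with hw
  have hpos := dotProduct_self_pos hns
  have hd := fun i => hasFDerivAt_gradF hU hF hu hx i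
  have hsq : HasFDerivAt (fun y => w y ⬝ᵥ w y)
      (dotCLM ((2 : ℝ) • w x ᵥ* jacF n F u x)) x := by
    refine (HasFDerivAt.fun_sum fun k (_ : k ∈ Finset.univ) => (hd k).mul (hd k)).congr_fderiv ?_
    ext b
    simp only [_root_.sum_apply, _root_.add_apply, _root_.smul_apply, dotCLM_apply, smul_eq_mul]
    rw [smul_dotProduct, ← dotProduct_mulVec, smul_eq_mul, dotProduct, Finset.mul_sum]
    refine Finset.sum_congr rfl fun k _ => ?_
    simp only [mulVec]
    ring
  have hr := hsq.sqrt hpos.ne'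
  set ρ := √(w x ⬝ᵥ w x) with hρ
  have hρ0 : 0 < ρ := Real.sqrt_pos.2 hpos
  have hρ2 : ρ ^ 2 = w x ⬝ᵥ w x := Real.sq_sqrt hpos.le
  have hleg : ∀ i, HasFDerivAt (fun y => legN n F u y i)
      (dotCLM (ρ⁻¹ • jacF n F u x i - (w x i / ρ ^ 3) • w x ᵥ* jacF n F u x)) x := fun i => by
    have h1 : (fun y => legN n F u y i) = fun y => w y i * (√(w y ⬝ᵥ w y))⁻¹ := by
      ext y
      simp only [legN, dotProduct, ← hw, ← sq, div_eq_mul_inv]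
    rw [h1]
    have h2 := (hasDerivAt_inv hρ0.ne').comp_hasFDerivAt x hr
    refine ((hd i).mul h2).congr_fderiv ?_
    ext b
    simp only [_root_.add_apply, _root_.smul_apply, dotCLM_apply, smul_eq_mul,
      sub_dotProduct, smul_dotProduct, Function.comp_apply, ← hw, ← hρ]
    field_simp
    ring
  have hi : ∀ i : Fin n, pd n i (fun y => legN n F u y i) x =
      ρ⁻¹ * jacF n F u x i i - w x i / ρ ^ 3 * (w x ᵥ* jacF n F u x) i := fun i => by
    rw [pd_eq_of_hasFDerivAt (hleg i)]
    simp
  simp only [Hmc, hi, Finset.sum_sub_distrib, ← Finset.mul_sum]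
  have h3 : ∑ i, w x i / ρ ^ 3 * (w x ᵥ* jacF n F u x) i =
      (w x ⬝ᵥ jacF n F u x *ᵥ w x) / ρ ^ 3 := by
    rw [dotProduct_mulVec, dotProduct, Finset.sum_div]
    refine Finset.sum_congr rfl fun i _ => ?_
    ring
  rw [h3, horTrace, ← hρ2]
  simp only [trace, diag_apply]
  field_simp

theorem jetOn_sub (hU : IsOpen U) (hF : ContDiffOn ℝ 1 F U) (hu : ContDiffOn ℝ 2 u U)
    {v : (Fin n → ℝ) → ℝ} (hv : ContDiffOn ℝ 2 v U) :
    JetOn U (fun x => u x - v x) (fun x => gradF n F u x - gradF n F v x)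
      (fun x => jacF n F u x - jacF n F v x) := by
  refine ⟨fun x hx => ?_, fun x hx i => ?_, fun i j => ?_⟩
  · have h := fun {f} (hf : ContDiffOn ℝ 2 f U) => hasFDerivAt_dotCLM_pd
      ((hf.contDiffAt (hU.mem_nhds hx)).differentiableAt two_ne_zero)
    refine ((h hu).sub (h hv)).congr_fderiv ?_
    ext b
    simp only [_root_.sub_apply, dotCLM_apply, ← sub_dotProduct]
    congr 1
    ext i
    simp [gradF]
  · refine ((hasFDerivAt_gradF hU hF hu hx i).sub (hasFDerivAt_gradF hU hF hv hx i)).congr_fderiv ?_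
    ext b
    simp only [_root_.sub_apply, dotCLM_apply, ← sub_dotProduct]
    rfl
  · exact (continuousOn_jacF hU hF hu i j).sub (continuousOn_jacF hU hF hv i j)

/-- The difference of two functions with ordered horizontal mean curvatures is locally a
supersolution of a linear degenerate elliptic inequality near a contact point. -/
theorem exists_local_supersolution (hU : IsOpen U) (hF : ContDiffOn ℝ 1 F U)
    (hu : ContDiffOn ℝ 2 u U) {v : (Fin n → ℝ) → ℝ} (hv : ContDiffOn ℝ 2 v U)
    (hns_u : ∀ x ∈ U, gradF n F u x ≠ 0) (hns_v : ∀ x ∈ U, gradF n F v x ≠ 0)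
    (hH : ∀ x ∈ U, Hmc n F u x ≤ Hmc n F v x) {p : Fin n → ℝ} (hp : p ∈ U)
    (hgrad : gradF n F u p = gradF n F v p) :
    ∃ s ⊆ U, IsOpen s ∧ p ∈ s ∧ ∃ C : ℝ, ∀ x ∈ s,
      horTrace (gradF n F u x) (jacF n F u x - jacF n F v x) ≤
        C * ‖gradF n F u x - gradF n F v x‖ := by
  obtain ⟨K, t, ht, hK⟩ := exists_lipschitzOnWith_horTrace_div (hns_v p hp)
    (fun i j => jacF n F v p i j)
  have hcg : ∀ {f : (Fin n → ℝ) → ℝ}, ContDiffOn ℝ 2 f U → ContinuousAt (gradF n F f) p :=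
    fun hf => continuousAt_pi.2 fun i => (hasFDerivAt_gradF hU hF hf hp i).continuousAt
  have hcj : ContinuousAt (fun x => (fun i j => jacF n F v x i j : Fin n → Fin n → ℝ)) p :=
    continuousAt_pi.2 fun i => continuousAt_pi.2 fun j =>
      (continuousOn_jacF hU hF hv i j).continuousAt (hU.mem_nhds hp)
  have hcu := (hcg hu).prodMk hcj
  have hcv := (hcg hv).prodMk hcj
  have htu : ∀ a, a = gradF n F v p → t ∈ 𝓝 (a, fun i j => jacF n F v p i j) := by
    rintro _ rfl
    exact ht
  have h1 := hcu.eventually (show t ∈ _ from htu _ hgrad)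
  have h2 := hcv.eventually (show t ∈ _ from ht)
  set ρ : (Fin n → ℝ) → ℝ := fun x => √(gradF n F u x ⬝ᵥ gradF n F u x) ^ 3 with hρ
  have hρc : ContinuousAt ρ p := by
    refine (Real.continuous_sqrt.continuousAt.comp ?_).pow 3
    exact ContinuousAt.comp (g := fun a : Fin n → ℝ => a ⬝ᵥ a)
      (by simp only [dotProduct]; fun_prop) (hcg hu)
  have h3 : ∀ᶠ x in 𝓝 p, ρ x < ρ p + 1 := hρc.eventually (gt_mem_nhds (by linarith))
  obtain ⟨s, hs, hso, hps⟩ := eventually_nhds_iff.1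
    (((h1.and h2).and h3).and (hU.eventually_mem hp))
  refine ⟨s, fun x hx => (hs x hx).2, hso, hps, (ρ p + 1) * K, fun x hx => ?_⟩
  obtain ⟨⟨⟨h4, h5⟩, h6⟩, hxU⟩ := hs x hx
  have h7 := hK.dist_le_mul _ h5 _ h4
  rw [Real.dist_eq, Prod.dist_eq, dist_self, max_eq_left dist_nonneg, dist_comm,
    dist_eq_norm] at h7
  have h8 := hH x hxU
  rw [Hmc_eq hU hF hu hxU (hns_u x hxU), Hmc_eq hU hF hv hxU (hns_v x hxU)] at h8
  have h9 := (le_abs_self _).trans h7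
  have hof : (Matrix.of fun i j => jacF n F v x i j) = jacF n F v x := rfl
  simp only [hof] at h9
  have hρx : 0 < ρ x := pow_pos (Real.sqrt_pos.2 (dotProduct_self_pos (hns_u x hxU))) 3
  have h10 : horTrace (gradF n F u x) (jacF n F u x - jacF n F v x) / ρ x ≤
      K * ‖gradF n F u x - gradF n F v x‖ := by
    have : horTrace (gradF n F u x) (jacF n F u x - jacF n F v x) =
        horTrace (gradF n F u x) (jacF n F u x) - horTrace (gradF n F u x) (jacF n F v x) := by
      rw [eq_sub_iff_add_eq, ← horTrace_add, sub_add_cancel]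
    rw [this, sub_div]
    linarith
  rw [div_le_iff₀ hρx] at h10
  refine h10.trans ?_
  rw [mul_comm, mul_assoc]
  exact mul_le_mul_of_nonneg_right h6.le (by positivity)

end

/-- Corollary H: strong maximum principle for `H_F` when the
curl matrix of `F` has rank at least `3` everywhere. -/
theorem strong_max_principle_curl_rank_ge_three
    (m : ℕ) (hm : 3 ≤ m)
    (U : Set (Fin m → ℝ)) (hUopen : IsOpen U) (hUconn : IsConnected U)
    (F : (Fin m → ℝ) → (Fin m → ℝ)) (hF : ContDiffOn ℝ 1 F U)
    (u v : (Fin m → ℝ) → ℝ)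
    (hu : ContDiffOn ℝ 2 u U) (hv : ContDiffOn ℝ 2 v U)
    (hns_u : ∀ x ∈ U, gradF m F u x ≠ 0)
    (hns_v : ∀ x ∈ U, gradF m F v x ≠ 0)
    (hH : ∀ x ∈ U, Hmc m F u x ≤ Hmc m F v x)
    (huv : ∀ x ∈ U, v x ≤ u x)
    (p₀ : Fin m → ℝ) (hp₀ : p₀ ∈ U) (htouch : u p₀ = v p₀)
    (hrank : ∀ x ∈ U, 3 ≤ (curlMatrix m F x).rank) :
    ∀ x ∈ U, u x = v x := by
  have H := jetOn_sub hUopen hF hu hv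
  have hφ : ∀ x ∈ U, 0 ≤ u x - v x := fun x hx => sub_nonneg.2 (huv x hx)
  have hB := fun x hx i => hasFDerivAt_gradF hUopen hF hu (x := x) hx i
  have hr : ∀ x ∈ U, 3 ≤ (jacF m F u x - (jacF m F u x)ᵀ).rank := fun x hx => by
    rw [jacF_sub_transpose hUopen hF hu hx, rank_transpose]
    exact hrank x hx
  have hlocal : ∀ p ∈ U, u p - v p = 0 → ∀ᶠ x in 𝓝 p, u x - v x = 0 := by
    intro p hp hp0
    have hmin : IsLocalMin (fun x => u x - v x) p := by
      filter_upwards [hUopen.mem_nhds hp] with x hx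
      rw [hp0]
      exact hφ x hx
    have hgrad := sub_eq_zero.1 (H.grad_eq_zero_of_isLocalMin hp hmin)
    obtain ⟨s, hsU, hso, hps, C, hC⟩ :=
      exists_local_supersolution hUopen hF hu hv hns_u hns_v hH hp hgrad
    exact JetOn.eventually_eq_zero hso (fun x hx => hns_u x (hsU hx)) (H.mono hsU)
      (fun x hx => hφ x (hsU hx)) hC (fun x hx => hB x (hsU hx)) (fun x hx => hr x (hsU hx))
      hps hp0
  have hsub : U ⊆ {x | ∀ᶠ y in 𝓝 x, u y - v y = 0} := by
    refine hUconn.isPreconnected.subset_of_closure_inter_subset isOpen_setOfPred_eventually_nhds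
      ⟨p₀, hp₀, hlocal p₀ hp₀ (sub_eq_zero.2 htouch)⟩ ?_
    rintro x ⟨hx, hxU⟩
    refine hlocal x hxU ?_
    have hfreq := mem_closure_iff_frequently.1 hx
    have hcont := (H.hasGrad x hxU).continuousAt
    by_contra hne
    obtain ⟨y, hy1, hy2⟩ := (hfreq.and_eventually (hcont.eventually_ne hne)).exists
    exact hy2 hy1.self_of_nhds
  exact fun x hx => sub_eq_zero.1 (hsub hx).self_of_nhds
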